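/- arXiv:2210.07950 — 3 statements merged into one kernel-verified Lean document; each statement's English description precedes it below -/
import Mathlib

section
/- Let m ≥ 1 and λ > ω_{r,m} := 2m r₀. Then for all 0 < x₀ < x₁ ≤ ∞: ∫_{x₀}^{x₁} (λ + a(s)) e^{−λR(s) − Q(s)} (1+s^m)/r(s) ds ≤ (λ/(λ − ω_{r,m})) · e^{−λR(x₀) − Q(x₀)} (1+x₀^m). -/
open MeasureTheory Set Filter

theorem rpow_sub_one_le_one_add_rpow {x m : ℝ} (hx : 0 < x) (hm : 1 ≤ m) :
    x ^ (m - 1) ≤ 1 + x ^ m := by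
  rcases le_total x 1 with h | h
  · have := Real.rpow_le_one hx.le h (sub_nonneg.2 hm)
    have := Real.rpow_nonneg hx.le m
    linarith
  · have := Real.rpow_le_rpow_of_exponent_le h (show m - 1 ≤ m by linarith)
    linarith

/-- The derivative of the weight `1 + x ^ m` is controlled by the weight divided by any rate `ρ`
of at most linear growth. -/
theorem mul_rpow_sub_one_le_of_le {x m r₀ ρ : ℝ} (hx : 0 < x) (hm : 1 ≤ m) (hr₀ : 0 < r₀)
    (hρ : 0 < ρ) (hρ_le : ρ ≤ r₀ * (1 + x)) :
    m * x ^ (m - 1) ≤ 2 * m * r₀ * ((1 + x ^ m) / ρ) := by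
  rw [← mul_div_assoc, le_div_iff₀ hρ]
  have hp : 0 ≤ x ^ (m - 1) := Real.rpow_nonneg hx.le _
  have hsucc : x ^ (m - 1) * x = x ^ m := by
    rw [← Real.rpow_add_one hx.ne', sub_add_cancel]
  calc m * x ^ (m - 1) * ρ ≤ m * x ^ (m - 1) * (r₀ * (1 + x)) := by gcongr
    _ = m * r₀ * (x ^ (m - 1) + x ^ m) := by rw [← hsucc]; ring
    _ ≤ m * r₀ * (2 * (1 + x ^ m)) := by
      have := rpow_sub_one_le_one_add_rpow hx hm
      gcongr
      linarith
    _ = 2 * m * r₀ * (1 + x ^ m) := by ring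

theorem eqOn_intervalIntegral_of_eq_setIntegral_Ioo {f F : ℝ → ℝ}
    (hF : ∀ x, 0 < x → F x = ∫ s in Ioo (0:ℝ) x, f s) :
    EqOn F (fun x => ∫ s in (0:ℝ)..x, f s) (Ioi 0) := fun x hx => by
  simp only [hF x hx, intervalIntegral.integral_of_le (le_of_lt hx), integral_Ioc_eq_integral_Ioo]

theorem hasDerivAt_of_eq_setIntegral_Ioo {f F : ℝ → ℝ}
    (hf : ∀ x, 0 < x → IntervalIntegrable f volume 0 x) (hc : ContinuousOn f (Ioi 0))
    (hF : ∀ x, 0 < x → F x = ∫ s in Ioo (0:ℝ) x, f s) {x : ℝ} (hx : 0 < x) :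
    HasDerivAt F (f x) x :=
  (intervalIntegral.integral_hasDerivAt_right (hf x hx)
    (hc.stronglyMeasurableAtFilter isOpen_Ioi x hx)
    (hc.continuousAt (Ioi_mem_nhds hx))).congr_of_eventuallyEq
    ((eqOn_intervalIntegral_of_eq_setIntegral_Ioo hF).eventuallyEq_of_mem (Ioi_mem_nhds hx))

theorem ae_hasDerivAt_of_eq_setIntegral_Ioo {f F : ℝ → ℝ}
    (hf : ∀ x, 0 < x → IntervalIntegrable f volume 0 x)
    (hF : ∀ x, 0 < x → F x = ∫ s in Ioo (0:ℝ) x, f s) :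
    ∀ᵐ x, 0 < x → HasDerivAt F (f x) x := by
  have key : ∀ᵐ x, ∀ n : ℕ, x ∈ uIcc (0:ℝ) (n + 1) → ∀ c ∈ uIcc (0:ℝ) (n + 1),
      HasDerivAt (fun y => ∫ t in c..y, f t) (f x) x :=
    ae_all_iff.2 fun n => (hf (n + 1) (by positivity)).ae_hasDerivAt_integral
  filter_upwards [key] with x hx hx0
  obtain ⟨n, hn⟩ := exists_nat_ge x
  have hxn : x ∈ uIcc (0:ℝ) (n + 1) := by
    rw [uIcc_of_le (by positivity)]
    exact ⟨hx0.le, by linarith⟩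
  exact (hx n hxn 0 left_mem_uIcc).congr_of_eventuallyEq
    ((eqOn_intervalIntegral_of_eq_setIntegral_Ioo hF).eventuallyEq_of_mem (Ioi_mem_nhds hx0))

/-- A nonnegative function dominated a.e. by a multiple of `-G'`, with `G` antitone and
nonnegative, has integral at most that multiple of the initial value of `G`. -/
theorem setLIntegral_Ioi_le_of_ae_le_neg_deriv {f G G' : ℝ → ℝ} {C x₀ : ℝ} (hC : 0 ≤ C)
    (hG : AntitoneOn G (Ici x₀)) (hG_nonneg : ∀ x ∈ Ioi x₀, 0 ≤ G x)
    (hG' : ∀ᵐ x, x ∈ Ioi x₀ → HasDerivAt G (G' x) x)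
    (hf : ∀ x ∈ Ioi x₀, f x ≤ C * -G' x) :
    ∫⁻ s in Ioi x₀, ENNReal.ofReal (f s) ≤ ENNReal.ofReal (C * G x₀) := by
  obtain ⟨t, ht_sub, ht_meas, ht_null⟩ := exists_measurable_superset_of_null (ae_iff.1 hG')
  have hderiv : ∀ x ∈ Ioi x₀ \ t, HasDerivWithinAt G (G' x) (Ioi x₀ \ t) x := fun x hx => by
    by_contra h
    exact hx.2 (ht_sub fun h' => h (h' hx.1).hasDerivWithinAt)
  have himage : G '' (Ioi x₀ \ t) ⊆ Icc 0 (G x₀) := by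
    rintro _ ⟨x, hx, rfl⟩
    exact ⟨hG_nonneg x hx.1, hG self_mem_Ici (Ioi_subset_Ici_self hx.1) (le_of_lt hx.1)⟩
  have hmeas : MeasurableSet (Ioi x₀ \ t) := measurableSet_Ioi.diff ht_meas
  calc ∫⁻ s in Ioi x₀, ENNReal.ofReal (f s)
      = ∫⁻ s in Ioi x₀ \ t, ENNReal.ofReal (f s) :=
        (setLIntegral_congr (sdiff_null_ae_eq_self ht_null)).symm
    _ ≤ ∫⁻ s in Ioi x₀ \ t, ENNReal.ofReal C * ENNReal.ofReal (-G' s) :=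
        setLIntegral_mono' hmeas fun x hx =>
          (ENNReal.ofReal_le_ofReal (hf x hx.1)).trans_eq (ENNReal.ofReal_mul hC)
    _ = ENNReal.ofReal C * volume (G '' (Ioi x₀ \ t)) := by
        rw [lintegral_const_mul' _ _ ENNReal.ofReal_ne_top,
          lintegral_deriv_eq_volume_image_of_antitoneOn hmeas hderiv
            (hG.mono (sdiff_subset.trans Ioi_subset_Ici_self))]
    _ ≤ ENNReal.ofReal C * volume (Icc 0 (G x₀)) := by gcongr
    _ = ENNReal.ofReal (C * G x₀) := by
        rw [Real.volume_Icc, sub_zero, ENNReal.ofReal_mul hC]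

/-- The estimate `P_{m,2}(x₀,x₁) ≤ λ e^{-λR(x₀)-Q(x₀)}(1+x₀^m)/(λ-ω_{r,m})`
for all `0 < x₀ < x₁ ≤ ∞`, where `R(x) = ∫₀^x ds/r(s)`, `Q(x) = ∫₀^x a(s)/r(s) ds`
and `ω_{r,m} = 2 m r₀`. -/
theorem Pm2_estimate (m r₀ lam : ℝ) (r a R Q : ℝ → ℝ)
    (hm : 1 ≤ m) (hr₀ : 0 < r₀)
    (hr_cont : ContinuousOn r (Ioi 0))
    (hr_pos : ∀ x, 0 < x → 0 < r x)
    (hr_bound : ∀ x, 0 < x → r x ≤ r₀ * (1 + x))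
    (hr_int : IntegrableOn (fun s => 1 / r s) (Ioo 0 1))
    (ha_meas : Measurable a)
    (ha_nonneg : ∀ x, 0 < x → 0 ≤ a x)
    (ha_locbdd : ∀ c, 0 < c → ∃ M, ∀ x ∈ Ioc (0:ℝ) c, a x ≤ M)
    (hR : ∀ x, 0 < x → R x = ∫ s in Ioo (0:ℝ) x, 1 / r s)
    (hQ : ∀ x, 0 < x → Q x = ∫ s in Ioo (0:ℝ) x, a s / r s)
    (hlam : 2 * m * r₀ < lam) :
    (∀ x₀ x₁ : ℝ, 0 < x₀ → x₀ < x₁ →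
      ∫⁻ s in Ioo x₀ x₁,
          ENNReal.ofReal ((lam + a s) * Real.exp (-(lam * R s) - Q s) * (1 + s ^ m) / r s)
        ≤ ENNReal.ofReal
            (lam / (lam - 2 * m * r₀) * Real.exp (-(lam * R x₀) - Q x₀) * (1 + x₀ ^ m))) ∧
    (∀ x₀ : ℝ, 0 < x₀ →
      ∫⁻ s in Ioi x₀,
          ENNReal.ofReal ((lam + a s) * Real.exp (-(lam * R s) - Q s) * (1 + s ^ m) / r s)
        ≤ ENNReal.ofReal
            (lam / (lam - 2 * m * r₀) * Real.exp (-(lam * R x₀) - Q x₀) * (1 + x₀ ^ m))) := by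
  have hlam0 : 0 < lam := lt_trans (by positivity) hlam
  have hgap : 0 < lam - 2 * m * r₀ := sub_pos.2 hlam
  have hinv_cont : ContinuousOn (fun s => 1 / r s) (Ioi 0) :=
    continuousOn_const.div hr_cont fun x hx => (hr_pos x hx).ne'
  have hinv_int : ∀ x, 0 < x → IntervalIntegrable (fun s => 1 / r s) volume 0 x := fun x hx => by
    have h01 : IntervalIntegrable (fun s => 1 / r s) volume 0 1 :=
      (intervalIntegrable_iff_integrableOn_Ioo_of_le zero_le_one).2 hr_int
    exact h01.trans (hinv_cont.mono fun y hy =>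
      (lt_min one_pos hx).trans_le hy.1).intervalIntegrable
  have hQ_int : ∀ x, 0 < x → IntervalIntegrable (fun s => a s / r s) volume 0 x := fun x hx => by
    obtain ⟨M, hM⟩ := ha_locbdd x hx
    have hinv := (intervalIntegrable_iff_integrableOn_Ioc_of_le hx.le).1 (hinv_int x hx)
    rw [intervalIntegrable_iff_integrableOn_Ioc_of_le hx.le]
    refine (hinv.bdd_mul (c := M) ha_meas.aestronglyMeasurable ?_).congr
      (ae_of_all _ fun s => mul_one_div _ _)
    filter_upwards [ae_restrict_mem measurableSet_Ioc] with s hs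
    rw [Real.norm_of_nonneg (ha_nonneg s hs.1)]
    exact hM s hs
  have hR' : ∀ x, 0 < x → HasDerivAt R (1 / r x) x := fun x hx =>
    hasDerivAt_of_eq_setIntegral_Ioo hinv_int hinv_cont hR hx
  have hw' : ∀ x : ℝ, 0 < x → HasDerivAt (fun s : ℝ => 1 + s ^ m) (m * x ^ (m - 1)) x :=
    fun x hx => (Real.hasDerivAt_rpow_const (Or.inl hx.ne')).const_add 1
  have hweight : ∀ x, 0 < x → m * x ^ (m - 1) ≤ 2 * m * r₀ * ((1 + x ^ m) / r x) := fun x hx =>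
    mul_rpow_sub_one_le_of_le hx hm hr₀ (hr_pos x hx) (hr_bound x hx)
  have hquot : ∀ x, 0 < x → 0 ≤ (1 + x ^ m) / r x := fun x hx =>
    div_nonneg (by positivity) (hr_pos x hx).le
  have hQ_mono : MonotoneOn Q (Ioi 0) := fun x hx y hy hxy => by
    rw [hQ x hx, hQ y hy]
    refine setIntegral_mono_set
      ((intervalIntegrable_iff_integrableOn_Ioo_of_le (le_of_lt hy)).1 (hQ_int y hy)) ?_
      (Ioo_subset_Ioo_right hxy).eventuallyLE
    filter_upwards [ae_restrict_mem measurableSet_Ioo] with s hs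
    exact div_nonneg (ha_nonneg s hs.1) (hr_pos s hs.1).le
  have hRw' : ∀ x, 0 < x → HasDerivAt (fun s => Real.exp (-(lam * R s)) * (1 + s ^ m))
      (Real.exp (-(lam * R x)) * -(lam * (1 / r x)) * (1 + x ^ m)
        + Real.exp (-(lam * R x)) * (m * x ^ (m - 1))) x := fun x hx =>
    ((hR' x hx).const_mul lam).neg.exp.mul (hw' x hx)
  have hRw_anti : AntitoneOn (fun s => Real.exp (-(lam * R s)) * (1 + s ^ m)) (Ioi 0) := by
    refine antitoneOn_of_deriv_nonpos (convex_Ioi 0)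
      (fun x hx => (hRw' x hx).continuousAt.continuousWithinAt)
      (fun x hx => (hRw' x (interior_subset hx)).differentiableAt.differentiableWithinAt)
      fun x hx => ?_
    replace hx : 0 < x := interior_subset hx
    rw [(hRw' x hx).deriv]
    have hle : m * x ^ (m - 1) ≤ lam * ((1 + x ^ m) / r x) :=
      (hweight x hx).trans (mul_le_mul_of_nonneg_right hlam.le (hquot x hx))
    calc _ = Real.exp (-(lam * R x)) * (m * x ^ (m - 1) - lam * ((1 + x ^ m) / r x)) := by ring
      _ ≤ 0 := mul_nonpos_of_nonneg_of_nonpos (Real.exp_nonneg _) (sub_nonpos.2 hle)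
  have hG_anti : AntitoneOn (fun s => Real.exp (-(lam * R s) - Q s) * (1 + s ^ m)) (Ioi 0) := by
    intro x hx y hy hxy
    have hsplit : ∀ s, Real.exp (-(lam * R s) - Q s) * (1 + s ^ m)
        = Real.exp (-(lam * R s)) * (1 + s ^ m) * Real.exp (-Q s) := fun s => by
      rw [sub_eq_add_neg, Real.exp_add]; ring
    have hx0 : 0 < x := hx
    simp only [hsplit]
    exact mul_le_mul (hRw_anti hx hy hxy)
      (Real.exp_le_exp.2 (neg_le_neg (hQ_mono hx hy hxy))) (Real.exp_nonneg _) (by positivity)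
  have hunbounded : ∀ x₀ : ℝ, 0 < x₀ →
      ∫⁻ s in Ioi x₀,
          ENNReal.ofReal ((lam + a s) * Real.exp (-(lam * R s) - Q s) * (1 + s ^ m) / r s)
        ≤ ENNReal.ofReal
            (lam / (lam - 2 * m * r₀) * Real.exp (-(lam * R x₀) - Q x₀) * (1 + x₀ ^ m)) := by
    intro x₀ hx₀
    rw [mul_assoc (lam / _)]
    refine setLIntegral_Ioi_le_of_ae_le_neg_deriv
      (G := fun s => Real.exp (-(lam * R s) - Q s) * (1 + s ^ m))
      (G' := fun x => Real.exp (-(lam * R x) - Q x) * (-(lam * (1 / r x)) - a x / r x)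
          * (1 + x ^ m) + Real.exp (-(lam * R x) - Q x) * (m * x ^ (m - 1)))
      (by positivity) (hG_anti.mono (Ici_subset_Ioi.2 hx₀)) (fun x hx => ?_) ?_ fun x hx => ?_
    · have : 0 < x := hx₀.trans hx
      positivity
    · filter_upwards [ae_hasDerivAt_of_eq_setIntegral_Ioo hQ_int hQ] with x hQ' hx
      have hx0 : 0 < x := hx₀.trans hx
      exact (((hR' x hx0).const_mul lam).neg.sub (hQ' hx0)).exp.mul (hw' x hx0)
    · have hx0 : 0 < x := hx₀.trans hx
      set C := lam / (lam - 2 * m * r₀) with hC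
      set E := Real.exp (-(lam * R x) - Q x) with hE
      set q := (1 + x ^ m) / r x with hq
      have hCeq : C * (lam - 2 * m * r₀) = lam := div_mul_cancel₀ _ hgap.ne'
      have hC1 : 1 ≤ C := (one_le_div hgap).2 (sub_le_self _ (by positivity))
      have haq : 0 ≤ (C - 1) * (a x * q) :=
        mul_nonneg (sub_nonneg.2 hC1) (mul_nonneg (ha_nonneg x hx0) (hquot x hx0))
      have hCw := mul_le_mul_of_nonneg_left (hweight x hx0) (zero_le_one.trans hC1)
      have hkey : (lam + a x) * q ≤ C * ((lam + a x) * q - m * x ^ (m - 1)) := by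
        have : C * (lam - 2 * m * r₀) * q = lam * q := by rw [hCeq]
        linarith
      calc (lam + a x) * E * (1 + x ^ m) / r x = E * ((lam + a x) * q) := by rw [hq]; ring
        _ ≤ E * (C * ((lam + a x) * q - m * x ^ (m - 1))) :=
          mul_le_mul_of_nonneg_left hkey (Real.exp_nonneg _)
        _ = _ := by rw [hq]; ring
  exact ⟨fun x₀ x₁ hx₀ _ => (lintegral_mono_set Ioo_subset_Ioi_self).trans (hunbounded x₀ hx₀),
    hunbounded⟩
end

section
/- Let m ≥ 1, let β : (0,∞) → [0,∞) be measurable with β(x) ≤ β_m (1+x^m) for a.e. x > 0, and let λ > ω_{r,m} + β_m. Let u : (0,∞) → ℝ be such that u ∈ X_m, a·u ∈ X_m, the function ru is locally absolutely continuous on (0,∞) with (ru)' ∈ X_m, and lim_{x→0⁺} r(x)u(x) = 0. Set c = (∫₀^∞ β u dx)/(1 − ∫₀^∞ β e_λ dx) and v = u + c·e_λ. Then rv is locally absolutely continuous, lim_{x→0⁺} r(x)v(x) = ∫₀^∞ β(x)v(x) dx, and λ v(x) + (rv)'(x) + a(x)v(x) = λ u(x) + (ru)'(x) + a(x)u(x)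 for a.e. x > 0 (i.e. the multiplicative perturbation identity (λ − Z_{0,m})u = (λ − Z_{β,m})(I+E_λ)u holds). -/
open MeasureTheory Set Filter

/-- `e_λ(x) = e^{-λR(x)-Q(x)}/r(x)`. -/
noncomputable def elam (r R Q : ℝ → ℝ) (lam x : ℝ) : ℝ :=
  Real.exp (-(lam * R x) - Q x) / r x

theorem LipschitzOnWith.comp_absolutelyContinuousOnInterval {K : NNReal} {φ F : ℝ → ℝ}
    {a b : ℝ} {s : Set ℝ} (hφ : LipschitzOnWith K φ s)
    (hF : AbsolutelyContinuousOnInterval F a b) (hs : MapsTo F (uIcc a b) s) :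
    AbsolutelyContinuousOnInterval (φ ∘ F) a b := by
  rw [absolutelyContinuousOnInterval_iff] at hF ⊢
  intro ε hε
  obtain ⟨δ, hδ, h⟩ := hF (ε / (K + 1)) (by positivity)
  refine ⟨δ, hδ, fun E hE hlen => ?_⟩
  have hsum := h E hE hlen
  calc ∑ i ∈ Finset.range E.1, dist ((φ ∘ F) (E.2 i).1) ((φ ∘ F) (E.2 i).2)
      ≤ ∑ i ∈ Finset.range E.1, (K + 1) * dist (F (E.2 i).1) (F (E.2 i).2) := by
        refine Finset.sum_le_sum fun i hi => ?_
        obtain ⟨h₁, h₂⟩ := hE.1 i hi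
        refine (hφ.dist_le_mul _ (hs h₁) _ (hs h₂)).trans ?_
        gcongr
        linarith
    _ = (K + 1) * ∑ i ∈ Finset.range E.1, dist (F (E.2 i).1) (F (E.2 i).2) := by
        rw [Finset.mul_sum]
    _ < (K + 1) * (ε / (K + 1)) := by gcongr
    _ = ε := by field_simp

theorem IntervalIntegrable.exp_neg_integral_sub {g : ℝ → ℝ} {a b : ℝ} (A : ℝ)
    (hg : IntervalIntegrable g volume a b) :
    Real.exp (-(A + ∫ s in a..b, g s)) - Real.exp (-A) =
      ∫ x in a..b, -(g x * Real.exp (-(A + ∫ s in a..x, g s))) := by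
  set F : ℝ → ℝ := fun x => -(A + ∫ s in a..x, g s) with hFdef
  have hF : AbsolutelyContinuousOnInterval F a b := by
    have hconst : AbsolutelyContinuousOnInterval (fun _ : ℝ => A) a b :=
      contDiff_const.contDiffOn.absolutelyContinuousOnInterval
    exact (hconst.add (hg.absolutelyContinuousOnInterval_intervalIntegral left_mem_uIcc)).neg
  have hexp : AbsolutelyContinuousOnInterval (Real.exp ∘ F) a b := by
    obtain ⟨C, hC⟩ := hF.exists_bound
    obtain ⟨K, hK⟩ := (Real.contDiff_exp (n := 1)).contDiffOn.exists_lipschitzOnWith (by decide)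
      (convex_Icc (-C) C) isCompact_Icc
    exact hK.comp_absolutelyContinuousOnInterval hF fun x hx => abs_le.mp (hC x hx)
  have hsub := hexp.integral_deriv_eq_sub
  simp only [Function.comp_apply, hFdef, intervalIntegral.integral_same, add_zero] at hsub
  rw [← hsub]
  refine intervalIntegral.integral_congr_ae ?_
  filter_upwards [hg.ae_hasDerivAt_integral] with x hx hxab
  have hx' : x ∈ uIcc a b := uIoc_subset_uIcc hxab
  have hd := (((hx hx' a left_mem_uIcc).const_add A).neg).exp
  refine (HasDerivAt.deriv hd).trans ?_
  simp only [Pi.neg_apply]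
  ring

theorem intervalIntegrable_of_integrableOn_of_continuousOn {h : ℝ → ℝ}
    (hint : IntegrableOn h (Ioo 0 1)) (hcont : ContinuousOn h (Ioi 0)) {x : ℝ} (hx : 0 ≤ x) :
    IntervalIntegrable h volume 0 x := by
  rw [intervalIntegrable_iff_integrableOn_Ioc_of_le hx]
  have hIcc : IntegrableOn h (Icc (1 / 2) x) :=
    (hcont.mono fun y hy => lt_of_lt_of_le (by norm_num) hy.1).integrableOn_Icc
  refine (hint.union hIcc).mono_set fun y hy => ?_
  rcases lt_or_ge y 1 with h1 | h1
  · exact Or.inl ⟨hy.1, h1⟩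
  · exact Or.inr ⟨by linarith, hy.2⟩

theorem intervalIntegrable_mul_of_locally_bounded {a h : ℝ → ℝ} (ha_meas : Measurable a)
    (ha_nonneg : ∀ x, 0 < x → 0 ≤ a x) {x M : ℝ} (hx : 0 ≤ x)
    (hM : ∀ y ∈ Ioc 0 x, a y ≤ M) (hh : IntervalIntegrable h volume 0 x) :
    IntervalIntegrable (fun y => a y * h y) volume 0 x := by
  rw [intervalIntegrable_iff_integrableOn_Ioc_of_le hx] at hh ⊢
  refine Integrable.bdd_mul (c := M) hh ha_meas.aestronglyMeasurable ?_
  filter_upwards [ae_restrict_mem measurableSet_Ioc] with y hy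
  rw [Real.norm_of_nonneg (ha_nonneg y hy.1)]
  exact hM y hy

theorem continuousOn_Ici_primitive {h : ℝ → ℝ}
    (hh : ∀ x, 0 ≤ x → IntervalIntegrable h volume 0 x) :
    ContinuousOn (fun x => ∫ s in (0:ℝ)..x, h s) (Ici 0) := by
  intro x hx
  have hx1 : (0:ℝ) ≤ x + 1 := by linarith [mem_Ici.mp hx]
  have hc := intervalIntegral.continuousOn_primitive_interval' (hh (x + 1) hx1)
    (left_mem_uIcc)
  rw [uIcc_of_le hx1] at hc
  refine (hc x ⟨hx, by linarith⟩).mono_of_mem_nhdsWithin ?_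
  rw [← Ici_inter_Iic]
  exact inter_mem self_mem_nhdsWithin
    (mem_nhdsWithin_of_mem_nhds (Iic_mem_nhds (by linarith)))

theorem tendsto_primitive_nhdsWithin_zero {h : ℝ → ℝ}
    (hh : ∀ x, 0 ≤ x → IntervalIntegrable h volume 0 x) :
    Tendsto (fun x => ∫ s in (0:ℝ)..x, h s) (nhdsWithin 0 (Ioi 0)) (nhds 0) := by
  have hc := (continuousOn_Ici_primitive hh 0 self_mem_Ici).mono Ioi_subset_Ici_self
  simpa [ContinuousWithinAt] using hc

theorem hasDerivAt_primitive_of_continuousOn {h : ℝ → ℝ} (hcont : ContinuousOn h (Ioi 0))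
    (hh : ∀ x, 0 ≤ x → IntervalIntegrable h volume 0 x) {x : ℝ} (hx : 0 < x) :
    HasDerivAt (fun x => ∫ s in (0:ℝ)..x, h s) (h x) x :=
  intervalIntegral.integral_hasDerivAt_right (hh x hx.le)
    (hcont.stronglyMeasurableAtFilter isOpen_Ioi x hx) (hcont.continuousAt (Ioi_mem_nhds hx))

/-- The polynomial weight is dominated by the exponential of the travel time
`∫₀ˣ ds / r(s)` when `r` grows at most linearly. -/
theorem one_add_rpow_le_exp {m r₀ : ℝ} {r : ℝ → ℝ} (hm : 1 ≤ m)
    (hr_cont : ContinuousOn (fun s => 1 / r s) (Ioi 0)) (hr_pos : ∀ x, 0 < x → 0 < r x)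
    (hr_bound : ∀ x, 0 < x → r x ≤ r₀ * (1 + x))
    (hh : ∀ x, 0 ≤ x → IntervalIntegrable (fun s => 1 / r s) volume 0 x) {x : ℝ} (hx : 0 ≤ x) :
    1 + x ^ m ≤ Real.exp (2 * m * r₀ * ∫ s in (0:ℝ)..x, 1 / r s) := by
  set T : ℝ → ℝ := fun x => ∫ s in (0:ℝ)..x, 1 / r s with hT
  set P : ℝ → ℝ := fun x => (1 + x ^ m) * Real.exp (-(2 * m * r₀ * T x)) with hP
  have hTc : ContinuousOn T (Ici 0) := continuousOn_Ici_primitive hh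
  have hPc : ContinuousOn P (Ici 0) := by
    have : Continuous fun x : ℝ => x ^ m := Real.continuous_rpow_const (by linarith)
    fun_prop
  have hPd : ∀ y, 0 < y → HasDerivAt P (m * y ^ (m - 1) * Real.exp (-(2 * m * r₀ * T y)) +
      (1 + y ^ m) * (Real.exp (-(2 * m * r₀ * T y)) * -(2 * m * r₀ * (1 / r y)))) y := by
    intro y hy
    have h₁ : HasDerivAt (fun x : ℝ => 1 + x ^ m) (m * y ^ (m - 1)) y :=
      (Real.hasDerivAt_rpow_const (Or.inl hy.ne')).const_add 1
    have h₂ : HasDerivAt (fun x => Real.exp (-(2 * m * r₀ * T x)))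
        (Real.exp (-(2 * m * r₀ * T y)) * -(2 * m * r₀ * (1 / r y))) y :=
      ((hasDerivAt_primitive_of_continuousOn hr_cont hh hy).const_mul (2 * m * r₀)).fun_neg.exp
    exact h₁.mul h₂
  have hanti : AntitoneOn P (Ici 0) := by
    refine antitoneOn_of_deriv_nonpos (convex_Ici 0) hPc ?_ ?_
    · rw [interior_Ici]
      exact fun y hy => (hPd y hy).differentiableAt.differentiableWithinAt
    · rw [interior_Ici]
      intro y hy
      have hy : 0 < y := hy
      rw [(hPd y hy).deriv]
      have hry := hr_pos y hy
      have hpow : y ^ m = y ^ (m - 1) * y := by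
        rw [← Real.rpow_add_one hy.ne', sub_add_cancel]
      have hp0 : 0 < y ^ (m - 1) := Real.rpow_pos_of_pos hy _
      have hle : y ^ (m - 1) ≤ 1 + y ^ m := by
        rcases le_total y 1 with h1 | h1
        · have := Real.rpow_le_one hy.le h1 (sub_nonneg.mpr hm)
          have := Real.rpow_pos_of_pos hy m
          linarith
        · nlinarith
      have hkey : m * y ^ (m - 1) ≤ (1 + y ^ m) * (2 * m * r₀ * (1 / r y)) := by
        have hr₀ : 0 < r₀ := by
          have := hry.trans_le (hr_bound y hy)
          exact pos_of_mul_pos_left this (by linarith)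
        rw [mul_one_div, mul_div_assoc', le_div_iff₀ hry]
        calc m * y ^ (m - 1) * r y ≤ m * y ^ (m - 1) * (r₀ * (1 + y)) := by
              have := hr_bound y hy
              gcongr
          _ = m * r₀ * (y ^ (m - 1) + y ^ m) := by rw [hpow]; ring
          _ ≤ m * r₀ * (2 * (1 + y ^ m)) := by
              gcongr
              linarith
          _ = (1 + y ^ m) * (2 * m * r₀) := by ring
      have he := Real.exp_pos (-(2 * m * r₀ * T y))
      nlinarith
  have h := hanti self_mem_Ici hx hx
  have hP0 : P 0 = 1 := by
    simp [hP, hT, Real.zero_rpow (by linarith : m ≠ 0)]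
  rw [hP0] at h
  have h' : (1 + x ^ m) * Real.exp (-(2 * m * r₀ * T x)) ≤ 1 := h
  rwa [Real.exp_neg, mul_inv_le_iff₀ (Real.exp_pos _), one_mul] at h'

theorem integral_exp_neg_primitive {μ : ℝ} {h : ℝ → ℝ} (hμ : 0 < μ)
    (hcont : ContinuousOn h (Ioi 0)) (hpos : ∀ x, 0 < x → 0 ≤ h x)
    (hh : ∀ x, 0 ≤ x → IntervalIntegrable h volume 0 x)
    (htop : Tendsto (fun x => ∫ s in (0:ℝ)..x, h s) atTop atTop) :
    IntegrableOn (fun x => Real.exp (-(μ * ∫ s in (0:ℝ)..x, h s)) * h x) (Ioi 0) ∧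
      ∫ x in Ioi 0, Real.exp (-(μ * ∫ s in (0:ℝ)..x, h s)) * h x = 1 / μ := by
  set T : ℝ → ℝ := fun x => ∫ s in (0:ℝ)..x, h s with hT
  set K : ℝ → ℝ := fun x => -(1 / μ) * Real.exp (-(μ * T x)) with hK
  have hKc : ContinuousWithinAt K (Ici 0) 0 := by
    have : ContinuousWithinAt T (Ici 0) 0 := continuousOn_Ici_primitive hh 0 self_mem_Ici
    fun_prop
  have hKd : ∀ x ∈ Ioi 0, HasDerivAt K (Real.exp (-(μ * T x)) * h x) x := by
    intro x hx
    have := (((hasDerivAt_primitive_of_continuousOn hcont hh hx).const_mul μ).fun_neg.exp).const_mul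
      (-(1 / μ))
    refine this.congr_deriv ?_
    change -(1 / μ) * (Real.exp (-(μ * T x)) * -(μ * h x)) = _
    field_simp
  have hKpos : ∀ x ∈ Ioi 0, 0 ≤ Real.exp (-(μ * T x)) * h x := fun x hx =>
    mul_nonneg (Real.exp_pos _).le (hpos x hx)
  have hKtop : Tendsto K atTop (nhds 0) := by
    have := (Real.tendsto_exp_neg_atTop_nhds_zero.comp (htop.const_mul_atTop hμ)).const_mul
      (-(1 / μ))
    simpa [hK] using this
  refine ⟨integrableOn_Ioi_deriv_of_nonneg hKc hKd hKpos hKtop, ?_⟩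
  rw [integral_Ioi_of_hasDerivAt_of_nonneg hKc hKd hKpos hKtop]
  simp [hK, hT]

theorem integrableOn_mul_of_le_weight {m C : ℝ} {b f : ℝ → ℝ} (hb_meas : Measurable b)
    (hb_nonneg : ∀ x, 0 < x → 0 ≤ b x)
    (hb_le : ∀ᵐ x ∂volume.restrict (Ioi 0), b x ≤ C * (1 + x ^ m))
    (hf : IntegrableOn (fun x => f x * (1 + x ^ m)) (Ioi 0)) :
    IntegrableOn (fun x => b x * f x) (Ioi 0) := by
  have hmeas : Measurable fun x : ℝ => b x / (1 + x ^ m) := by fun_prop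
  refine (Integrable.bdd_mul (c := C) hf hmeas.aestronglyMeasurable ?_).congr ?_
  · filter_upwards [hb_le, ae_restrict_mem measurableSet_Ioi] with x hbx hx
    have hw : 0 < 1 + x ^ m := by linarith [Real.rpow_pos_of_pos hx m]
    rw [Real.norm_of_nonneg (div_nonneg (hb_nonneg x hx) hw.le), div_le_iff₀ hw]
    exact hbx
  · filter_upwards [ae_restrict_mem measurableSet_Ioi] with x hx
    have hw : 0 < 1 + x ^ m := by linarith [Real.rpow_pos_of_pos hx m]
    field_simp

/-- The multiplicative perturbation identity
`(λ - Z_{0,m})u = (λ - Z_{β,m})(I+E_λ)u`: if `u` is in the domain of `Z_{0,m}`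
(i.e. `u, au ∈ X_m`, `ru` is locally absolutely continuous with `(ru)' = du ∈ X_m`, and
`r u → 0` at `0⁺`), then `v = u + c e_λ`, with
`c = (∫β u)/(1 - ∫β e_λ)`, satisfies: `rv` is locally absolutely continuous,
`r v → ∫ β v` at `0⁺`, and `λv + (rv)' + av = λu + (ru)' + au` a.e. on `(0,∞)`. -/
theorem multiplicative_perturbation (m r₀ betam lam : ℝ) (r a β R Q u du : ℝ → ℝ)
    (hm : 1 ≤ m) (hr₀ : 0 < r₀)
    (hr_cont : ContinuousOn r (Ioi 0))
    (hr_pos : ∀ x, 0 < x → 0 < r x)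
    (hr_bound : ∀ x, 0 < x → r x ≤ r₀ * (1 + x))
    (hr_int : IntegrableOn (fun s => 1 / r s) (Ioo 0 1))
    (ha_meas : Measurable a)
    (ha_nonneg : ∀ x, 0 < x → 0 ≤ a x)
    (ha_locbdd : ∀ c, 0 < c → ∃ M, ∀ x ∈ Ioc (0:ℝ) c, a x ≤ M)
    (hβ_meas : Measurable β)
    (hβ_nonneg : ∀ x, 0 < x → 0 ≤ β x)
    (hβm : 0 ≤ betam)
    (hβ_bound : ∀ᵐ x ∂volume.restrict (Ioi 0), β x ≤ betam * (1 + x ^ m))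
    (hR : ∀ x, 0 < x → R x = ∫ s in Ioo (0:ℝ) x, 1 / r s)
    (hQ : ∀ x, 0 < x → Q x = ∫ s in Ioo (0:ℝ) x, a s / r s)
    (hlam : 2 * m * r₀ + betam < lam)
    (hu_int : IntegrableOn (fun x => u x * (1 + x ^ m)) (Ioi 0))
    (hau_int : IntegrableOn (fun x => a x * u x * (1 + x ^ m)) (Ioi 0))
    (hdu_int : IntegrableOn (fun x => du x * (1 + x ^ m)) (Ioi 0))
    (hFTC : ∀ x₀ x₁ : ℝ, 0 < x₀ → x₀ ≤ x₁ →
      r x₁ * u x₁ - r x₀ * u x₀ = ∫ s in x₀..x₁, du s)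
    (hbc : Tendsto (fun x => r x * u x) (nhdsWithin 0 (Ioi 0)) (nhds 0)) :
    ∀ (c : ℝ) (v : ℝ → ℝ),  -- abbreviations: c is the constant, v = (I+E_λ)u
    c = (∫ y in Ioi 0, β y * u y) /
        (1 - ∫ y in Ioi 0, β y * elam r R Q lam y) →
    (∀ x, v x = u x + c * elam r R Q lam x) →
    ∃ dv : ℝ → ℝ,
      -- rv is locally absolutely continuous (with density dv)
      (∀ x₀ x₁ : ℝ, 0 < x₀ → x₀ ≤ x₁ →
        r x₁ * v x₁ - r x₀ * v x₀ = ∫ s in x₀..x₁, dv s) ∧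
      -- the McKendrick–von Foerster boundary condition holds for v
      Tendsto (fun x => r x * v x) (nhdsWithin 0 (Ioi 0))
        (nhds (∫ x in Ioi 0, β x * v x)) ∧
      -- (λ - Z_{β,m}) v = (λ - Z_{0,m}) u  a.e. on (0,∞)
      (∀ᵐ x ∂volume.restrict (Ioi 0),
        lam * v x + dv x + a x * v x = lam * u x + du x + a x * u x) := by
  intro c v hc hv
  set T : ℝ → ℝ := fun x => ∫ s in (0:ℝ)..x, 1 / r s with hT
  set ω : ℝ := 2 * m * r₀ with hω
  have hinv_cont : ContinuousOn (fun s => 1 / r s) (Ioi 0) :=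
    continuousOn_const.div hr_cont fun x hx => (hr_pos x hx).ne'
  have hinv : ∀ x, 0 ≤ x → IntervalIntegrable (fun s => 1 / r s) volume 0 x := fun x hx =>
    intervalIntegrable_of_integrableOn_of_continuousOn hr_int hinv_cont hx
  have har : ∀ x, 0 ≤ x → IntervalIntegrable (fun s => a s / r s) volume 0 x := by
    intro x hx
    obtain ⟨M, hM⟩ := ha_locbdd (x + 1) (by linarith)
    simp only [div_eq_mul_one_div (a _)]
    exact intervalIntegrable_mul_of_locally_bounded ha_meas ha_nonneg hx
      (fun y hy => hM y ⟨hy.1, by linarith [hy.2]⟩) (hinv x hx)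
  have hg : ∀ x, 0 ≤ x → IntervalIntegrable (fun s => lam * (1 / r s) + a s / r s) volume 0 x :=
    fun x hx => ((hinv x hx).const_mul lam).add (har x hx)
  set G : ℝ → ℝ := fun x => ∫ s in (0:ℝ)..x, (lam * (1 / r s) + a s / r s) with hG
  have hRT : ∀ x, 0 < x → R x = T x := fun x hx => by
    simp only [hR x hx, hT, intervalIntegral.integral_of_le hx.le, integral_Ioc_eq_integral_Ioo]
  have hRQ : ∀ x, 0 < x → -(lam * R x) - Q x = -G x := fun x hx => by
    have hQx : Q x = ∫ s in (0:ℝ)..x, a s / r s := by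
      rw [hQ x hx, intervalIntegral.integral_of_le hx.le, integral_Ioc_eq_integral_Ioo]
    rw [hRT x hx, hQx, hG]
    simp only
    rw [intervalIntegral.integral_add ((hinv x hx.le).const_mul lam) (har x hx.le),
      intervalIntegral.integral_const_mul]
    ring
  have hre : ∀ x, 0 < x → r x * elam r R Q lam x = Real.exp (-G x) := fun x hx => by
    rw [elam, hRQ x hx, mul_div_cancel₀ _ (hr_pos x hx).ne']
  have hQ_nonneg : ∀ x, 0 < x → 0 ≤ Q x := fun x hx => by
    rw [hQ x hx]
    exact setIntegral_nonneg measurableSet_Ioo fun s hs =>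
      div_nonneg (ha_nonneg s hs.1) (hr_pos s hs.1).le
  have hω_pos : 0 < ω := by positivity
  have hμ : 0 < lam - ω := by linarith
  have hweight : ∀ x, 0 ≤ x → 1 + x ^ m ≤ Real.exp (ω * T x) := fun x hx =>
    one_add_rpow_le_exp hm hinv_cont hr_pos hr_bound hinv hx
  have hT_top : Tendsto T atTop atTop := by
    have hexp : Tendsto (fun x => Real.exp (ω * T x)) atTop atTop := by
      refine tendsto_atTop_mono' _ ?_ (tendsto_rpow_atTop (by linarith : 0 < m))
      filter_upwards [eventually_ge_atTop 0] with x hx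
      linarith [hweight x hx]
    exact (tendsto_const_mul_atTop_of_pos hω_pos).1 (Real.tendsto_exp_comp_atTop.1 hexp)
  obtain ⟨hK_int, hK_val⟩ := integral_exp_neg_primitive hμ hinv_cont
    (fun x hx => (one_div_pos.2 (hr_pos x hx)).le) hinv hT_top
  have he_nonneg : ∀ x, 0 < x → 0 ≤ elam r R Q lam x := fun x hx =>
    div_nonneg (Real.exp_pos _).le (hr_pos x hx).le
  have he_weight : ∀ x, 0 < x → (1 + x ^ m) * elam r R Q lam x ≤
      Real.exp (-((lam - ω) * T x)) * (1 / r x) := fun x hx => by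
    rw [elam, ← mul_div_assoc, mul_one_div]
    refine div_le_div_of_nonneg_right ?_ (hr_pos x hx).le
    calc (1 + x ^ m) * Real.exp (-(lam * R x) - Q x)
        ≤ Real.exp (ω * T x) * Real.exp (-(lam * T x)) := by
          rw [hRT x hx]
          refine mul_le_mul (hweight x hx.le) (Real.exp_le_exp.2 ?_) (Real.exp_pos _).le
            (Real.exp_pos _).le
          linarith [hQ_nonneg x hx]
      _ = Real.exp (-((lam - ω) * T x)) := by
          rw [← Real.exp_add]
          ring_nf
  have hβe_le : ∀ᵐ x ∂volume.restrict (Ioi 0), β x * elam r R Q lam x ≤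
      betam * (Real.exp (-((lam - ω) * T x)) * (1 / r x)) := by
    filter_upwards [hβ_bound, ae_restrict_mem measurableSet_Ioi] with x hβx hx
    calc β x * elam r R Q lam x ≤ betam * (1 + x ^ m) * elam r R Q lam x :=
          mul_le_mul_of_nonneg_right hβx (he_nonneg x hx)
      _ = betam * ((1 + x ^ m) * elam r R Q lam x) := by ring
      _ ≤ _ := mul_le_mul_of_nonneg_left (he_weight x hx) hβm
  have he_meas : AEStronglyMeasurable (elam r R Q lam) (volume.restrict (Ioi 0)) := by
    have hGc : ContinuousOn G (Ioi 0) := (continuousOn_Ici_primitive hg).mono Ioi_subset_Ici_self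
    have : ContinuousOn (fun x => Real.exp (-G x) / r x) (Ioi 0) :=
      (Real.continuous_exp.comp_continuousOn hGc.neg).div hr_cont fun x hx => (hr_pos x hx).ne'
    refine (this.congr fun x hx => ?_).aestronglyMeasurable measurableSet_Ioi
    rw [elam, hRQ x hx]
  have hβe_int : IntegrableOn (fun x => β x * elam r R Q lam x) (Ioi 0) := by
    refine Integrable.mono' (hK_int.const_mul betam)
      (hβ_meas.aestronglyMeasurable.mul he_meas) ?_
    filter_upwards [hβe_le, ae_restrict_mem measurableSet_Ioi] with x hle hx
    rwa [Real.norm_of_nonneg (mul_nonneg (hβ_nonneg x hx) (he_nonneg x hx))]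
  have hβe_lt : ∫ x in Ioi 0, β x * elam r R Q lam x < 1 := by
    have hle := integral_mono_ae hβe_int (hK_int.const_mul betam) hβe_le
    rw [integral_const_mul, hK_val] at hle
    refine hle.trans_lt ?_
    rw [mul_one_div, div_lt_one hμ]
    linarith
  have hβu_int : IntegrableOn (fun x => β x * u x) (Ioi 0) :=
    integrableOn_mul_of_le_weight hβ_meas hβ_nonneg hβ_bound hu_int
  have hβv : ∫ x in Ioi 0, β x * v x = c := by
    have hsplit : (fun x => β x * v x) =
        fun x => β x * u x + c * (β x * elam r R Q lam x) := by
      ext x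
      rw [hv x]
      ring
    rw [hsplit, integral_add hβu_int (hβe_int.const_mul c), integral_const_mul, hc]
    have : 1 - ∫ x in Ioi 0, β x * elam r R Q lam x ≠ 0 := (sub_pos.2 hβe_lt).ne'
    field_simp
    ring
  refine ⟨fun x => du x - c * ((lam + a x) * elam r R Q lam x), ?_, ?_, ?_⟩
  · intro x₀ x₁ hx₀ hx₁
    have hx₁_pos : 0 < x₁ := hx₀.trans_le hx₁
    have hsub : uIcc x₀ x₁ ⊆ uIcc 0 x₁ := by
      rw [uIcc_of_le hx₁, uIcc_of_le hx₁_pos.le]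
      exact Icc_subset_Icc_left hx₀.le
    have hg₀₁ := (hg x₁ hx₁_pos.le).mono_set hsub
    have hGadd : ∀ x ∈ uIcc x₀ x₁,
        G x₀ + ∫ s in x₀..x, (lam * (1 / r s) + a s / r s) = G x := fun x hx => by
      have hx' : x₀ ≤ x := by
        rw [uIcc_of_le hx₁] at hx
        exact hx.1
      exact intervalIntegral.integral_add_adjacent_intervals (hg x₀ hx₀.le)
        ((hg x₀ hx₀.le).symm.trans (hg x (hx₀.le.trans hx')))
    have hcongr : EqOn (fun x => -((lam * (1 / r x) + a x / r x) *
        Real.exp (-(G x₀ + ∫ s in x₀..x, (lam * (1 / r s) + a s / r s)))))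
        (fun x => -((lam + a x) * elam r R Q lam x)) (uIcc x₀ x₁) := fun x hx => by
      have hx_pos : 0 < x := by
        rw [uIcc_of_le hx₁] at hx
        exact hx₀.trans_le hx.1
      simp only
      rw [hGadd x hx, elam, hRQ x hx_pos]
      ring
    have hexp := hg₀₁.exp_neg_integral_sub (G x₀)
    rw [hGadd x₁ right_mem_uIcc, ← hre x₀ hx₀, ← hre x₁ hx₁_pos,
      intervalIntegral.integral_congr hcongr] at hexp
    have hdu : IntervalIntegrable du volume x₀ x₁ := by
      rw [intervalIntegrable_iff_integrableOn_Ioc_of_le hx₁]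
      have h : IntegrableOn (fun x => 1 * du x) (Ioi 0) := by
        refine integrableOn_mul_of_le_weight (b := fun _ => 1) (C := 1) measurable_const
          (fun _ _ => zero_le_one) ?_ hdu_int
        filter_upwards [ae_restrict_mem measurableSet_Ioi] with x hx
        linarith [Real.rpow_pos_of_pos hx m]
      simp only [one_mul] at h
      exact h.mono_set fun x hx => hx₀.trans hx.1
    have hlame : IntervalIntegrable (fun x => (lam + a x) * elam r R Q lam x) volume x₀ x₁ := by
      have hGc : ContinuousOn G (uIcc x₀ x₁) :=
        (continuousOn_Ici_primitive hg).mono fun x hx => by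
          rw [uIcc_of_le hx₁] at hx
          exact hx₀.le.trans hx.1
      refine (hg₀₁.mul_continuousOn (Real.continuous_exp.comp_continuousOn hGc.neg)).congr ?_
      intro x hx
      have hx_pos : 0 < x := by
        rw [uIoc_of_le hx₁] at hx
        exact hx₀.trans hx.1
      simp only [Function.comp_apply, Pi.neg_apply, elam]
      rw [hRQ x hx_pos]
      ring
    rw [intervalIntegral.integral_sub hdu (hlame.const_mul c), ← hFTC x₀ x₁ hx₀ hx₁,
      intervalIntegral.integral_const_mul, hv, hv]
    rw [intervalIntegral.integral_neg] at hexp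
    linear_combination c * hexp
  · rw [hβv]
    have hexp : Tendsto (fun x => Real.exp (-G x)) (nhdsWithin 0 (Ioi 0)) (nhds 1) := by
      have := (tendsto_primitive_nhdsWithin_zero hg).neg
      rw [neg_zero] at this
      rw [← Real.exp_zero]
      exact (Real.continuous_exp.tendsto 0).comp this
    have hsum := hbc.add (hexp.const_mul c)
    rw [zero_add, mul_one] at hsum
    refine hsum.congr' ?_
    filter_upwards [self_mem_nhdsWithin] with x hx
    rw [hv x, ← hre x hx]
    ring
  · refine Eventually.of_forall fun x => ?_
    rw [hv x]
    ring
end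

section
/- Let m > 1, p,l ≥ 0 with m ≥ l + p and b₀ ≥ 1. Let r : (0,∞) → (0,∞) be continuous with r(x) ≤ r₀(1+x); let a be measurable with 0 ≤ a(x) ≤ a₀(1+x^p); let β be measurable with 0 ≤ β(x) ≤ β_m(1+x^m); let b ≥ 0 be measurable with b(x,y) = 0 for x > y, ∫₀^y x b(x,y) dx = y, and n₀(y) = ∫₀^y b(x,y) dx ≤ b₀(1+y^l). Then for every u ≥ 0 with u, a·u ∈ X_m, ru locally absolutely continuous, (ru)' ∈ X_m, and lim_{x→0⁺} r(x)u(x) = ∫₀^∞ β u dx, one has ∫₀^∞ [−(ru)'(x) − a(x)u(x) + ∫_x^∞ a(y)b(x,y)u(y) dy](1+x^m) dx ≤ (β_m + 2m r₀ + 4a₀b₀) ‖u‖_m. -/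
open MeasureTheory Set Filter

/-- Fubini's theorem on the triangle `0 < x < y`, for a nonnegative kernel `k`. -/
theorem integrable_and_integral_swap_triangle {g D : ℝ → ℝ} {k : ℝ → ℝ → ℝ}
    (hg : AEStronglyMeasurable g (volume.restrict (Ioi 0)))
    (hk : Measurable (Function.uncurry k))
    (hk_nonneg : ∀ y x, 0 < x → 0 ≤ k y x)
    (hk_int : ∀ y, 0 < y → IntegrableOn (k y) (Ioo 0 y))
    (hD : IntegrableOn D (Ioi 0))
    (hgD : ∀ y, 0 < y → |g y| * ∫ x in Ioo 0 y, k y x ≤ D y) :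
    IntegrableOn (fun x => ∫ y in Ioi x, g y * k y x) (Ioi 0) ∧
    IntegrableOn (fun y => g y * ∫ x in Ioo 0 y, k y x) (Ioi 0) ∧
    ∫ x in Ioi 0, ∫ y in Ioi x, g y * k y x =
      ∫ y in Ioi 0, g y * ∫ x in Ioo 0 y, k y x := by
  set μ : Measure ℝ := volume.restrict (Ioi 0) with hμ
  set T : Set (ℝ × ℝ) := {q | q.2 < q.1} with hT
  have hTm : MeasurableSet T := measurableSet_lt measurable_snd measurable_fst
  set F : ℝ × ℝ → ℝ := T.indicator fun q => g q.1 * k q.1 q.2 with hF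
  have hFm : AEStronglyMeasurable F (μ.prod μ) :=
    (hg.comp_fst.mul hk.aestronglyMeasurable).indicator hTm
  have hF_slice (y : ℝ) :
      (fun x => F (y, x)) = (Iio y).indicator fun x => g y * k y x := by
    ext x
    simp [hF, hT, indicator_apply]
  have hF_slice' (x : ℝ) :
      (fun y => F (y, x)) = (Ioi x).indicator fun y => g y * k y x := by
    ext y
    simp [hF, hT, indicator_apply]
  have hrestrict (y : ℝ) : μ.restrict (Iio y) = volume.restrict (Ioo 0 y) := by
    rw [hμ, Measure.restrict_restrict measurableSet_Iio, Iio_inter_Ioi]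
  have hrestrict' (x : ℝ) (hx : 0 < x) : μ.restrict (Ioi x) = volume.restrict (Ioi x) := by
    rw [hμ, Measure.restrict_restrict measurableSet_Ioi,
      inter_eq_left.2 (Ioi_subset_Ioi hx.le)]
  have hy_integral (y : ℝ) : ∫ x, F (y, x) ∂μ = g y * ∫ x in Ioo 0 y, k y x := by
    rw [hF_slice, integral_indicator measurableSet_Iio, hrestrict, integral_const_mul]
  have hx_integral (x : ℝ) (hx : 0 < x) :
      ∫ y, F (y, x) ∂μ = ∫ y in Ioi x, g y * k y x := by
    rw [hF_slice', integral_indicator measurableSet_Ioi, hrestrict' x hx]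
  have hy_norm (y : ℝ) : ∫ x, ‖F (y, x)‖ ∂μ = |g y| * ∫ x in Ioo 0 y, k y x := by
    have h : (fun x => ‖F (y, x)‖) = (Iio y).indicator fun x => ‖g y * k y x‖ := by
      ext x
      rw [congrFun (hF_slice y) x, norm_indicator_eq_indicator_norm]
    rw [h, integral_indicator measurableSet_Iio, hrestrict, ← integral_const_mul]
    refine setIntegral_congr_fun measurableSet_Ioo fun x hx => ?_
    simp [abs_of_nonneg (hk_nonneg y x hx.1)]
  have hFi : Integrable F (μ.prod μ) := by
    rw [integrable_prod_iff hFm]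
    constructor
    · filter_upwards [ae_restrict_mem measurableSet_Ioi] with y hy
      rw [hF_slice, integrable_indicator_iff measurableSet_Iio, IntegrableOn, hrestrict]
      exact (hk_int y hy).const_mul _
    · refine Integrable.mono' hD hFm.norm.integral_prod_right' ?_
      filter_upwards [ae_restrict_mem measurableSet_Ioi] with y hy
      rw [Real.norm_of_nonneg (integral_nonneg fun _ => norm_nonneg _), hy_norm]
      exact hgD y hy
  have hx_ae : (fun x => ∫ y, F (y, x) ∂μ) =ᵐ[μ] fun x => ∫ y in Ioi x, g y * k y x := by
    filter_upwards [ae_restrict_mem measurableSet_Ioi] with x hx using hx_integral x hx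
  refine ⟨hFi.integral_prod_right.congr hx_ae, ?_, ?_⟩
  · exact hFi.integral_prod_left.congr (.of_forall hy_integral)
  · rw [← integral_congr_ae hx_ae, ← integral_integral_swap (f := fun y x => F (y, x)) hFi]
    simp only [hy_integral]

theorem integrableOn_of_mul_one_add_rpow {f : ℝ → ℝ} {m : ℝ}
    (hf : IntegrableOn (fun x => f x * (1 + x ^ m)) (Ioi 0)) : IntegrableOn f (Ioi 0) := by
  have hm : Measurable fun x : ℝ => (1 + x ^ m)⁻¹ := by fun_prop
  have hpos (x : ℝ) (hx : 0 < x) : 0 < 1 + x ^ m := by positivity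
  have hfm : AEStronglyMeasurable f (volume.restrict (Ioi 0)) := by
    refine (hf.aestronglyMeasurable.mul hm.aestronglyMeasurable).congr ?_
    filter_upwards [ae_restrict_mem measurableSet_Ioi] with x hx
    simp [mul_assoc, mul_inv_cancel₀ (hpos x hx).ne']
  refine Integrable.mono hf hfm ?_
  filter_upwards [ae_restrict_mem measurableSet_Ioi] with x hx
  have hx' : (0 : ℝ) < x ^ m := Real.rpow_pos_of_pos hx m
  rw [norm_mul, Real.norm_of_nonneg (hpos x hx).le]
  exact le_mul_of_one_le_right (norm_nonneg _) (by linarith)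

theorem integrableOn_mul_rpow_of_mul_one_add_rpow {f : ℝ → ℝ} {m : ℝ}
    (hf : IntegrableOn (fun x => f x * (1 + x ^ m)) (Ioi 0)) :
    IntegrableOn (fun x => f x * x ^ m) (Ioi 0) :=
  (hf.sub (integrableOn_of_mul_one_add_rpow hf)).congr
    (.of_forall fun x => by simp only [Pi.sub_apply]; ring)

theorem rpow_le_one_add_rpow {x s m : ℝ} (hx : 0 < x) (hs : 0 ≤ s) (hsm : s ≤ m) :
    x ^ s ≤ 1 + x ^ m := by
  have hxm : 0 < x ^ m := Real.rpow_pos_of_pos hx m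
  rcases le_total x 1 with h | h
  · linarith [Real.rpow_le_one hx.le h hs]
  · linarith [Real.rpow_le_rpow_of_exponent_le h hsm]

/-- The transport part: `du` is the derivative of the nonnegative flux `v`. -/
theorem neg_integral_mul_one_add_rpow_le {m : ℝ} (hm : 1 < m) {v du w : ℝ → ℝ} {c : ℝ}
    (hv_nonneg : ∀ x, 0 < x → 0 ≤ v x)
    (hdu_int : IntegrableOn (fun x => du x * (1 + x ^ m)) (Ioi 0))
    (hFTC : ∀ x₀ x₁ : ℝ, 0 < x₀ → x₀ ≤ x₁ → v x₁ - v x₀ = ∫ s in x₀..x₁, du s)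
    (hv_lim : Tendsto v (nhdsWithin 0 (Ioi 0)) (nhds c))
    (hw_int : IntegrableOn w (Ioi 0))
    (hvw : ∀ x, 0 < x → m * x ^ (m - 1) * v x ≤ w x) :
    -∫ x in Ioi 0, du x * (1 + x ^ m) ≤ c + ∫ x in Ioi 0, w x := by
  have hdu := integrableOn_of_mul_one_add_rpow hdu_int
  have hdum := integrableOn_mul_rpow_of_mul_one_add_rpow hdu_int
  have htail (s : ℝ) (hs : 0 < s) : -v s ≤ ∫ x in Ioi s, du x := by
    refine ge_of_tendsto (intervalIntegral_tendsto_integral_Ioi s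
      (hdu.mono_set (Ioi_subset_Ioi hs.le)) tendsto_id) ?_
    filter_upwards [eventually_ge_atTop s] with R hR
    rw [id, ← hFTC s R hs hR]
    linarith [hv_nonneg R (hs.trans_le hR)]
  have htotal : -c ≤ ∫ x in Ioi 0, du x := by
    have hlim : Tendsto (fun s => ∫ x in Ioi s, du x) (nhdsWithin 0 (Ioi 0))
        (nhds (∫ x in Ioi 0, du x)) := by
      have h := (aecover_Ioi_of_Ioi (μ := volume) (A := (0 : ℝ))
        (tendsto_id.mono_left nhdsWithin_le_nhds :
          Tendsto id (nhdsWithin (0 : ℝ) (Ioi 0)) (nhds 0))).integral_tendsto_of_countably_generated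
            hdu
      refine h.congr' ?_
      filter_upwards [self_mem_nhdsWithin] with s hs
      rw [id, Measure.restrict_restrict measurableSet_Ioi,
        inter_eq_left.2 (Ioi_subset_Ioi (le_of_lt hs))]
    refine le_of_tendsto_of_tendsto hv_lim.neg hlim ?_
    filter_upwards [self_mem_nhdsWithin] with s hs using htail s hs
  have hkernel (y : ℝ) (hy : 0 < y) : ∫ x in Ioo 0 y, m * x ^ (m - 1) = y ^ m := by
    rw [← integral_Ioc_eq_integral_Ioo, ← intervalIntegral.integral_of_le hy.le,
      intervalIntegral.integral_const_mul, integral_rpow (Or.inl (by linarith)),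
      sub_add_cancel, Real.zero_rpow (by linarith)]
    field_simp
    ring
  obtain ⟨hint, -, hswap⟩ := integrable_and_integral_swap_triangle
    (g := du) (D := fun y => |du y * y ^ m|) (k := fun _ x => m * x ^ (m - 1))
    hdu.aestronglyMeasurable (by unfold Function.uncurry; fun_prop)
    (fun _ x hx => by positivity)
    (fun y hy => (((intervalIntegral.intervalIntegrable_rpow' (a := 0) (b := y)
      (by linarith : -1 < m - 1)).1.mono_set Ioo_subset_Ioc_self).const_mul m))
    hdum.abs
    (fun y hy => by
      rw [hkernel y hy, abs_mul, abs_of_pos (Real.rpow_pos_of_pos hy m)])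
  have hswap' : ∫ y in Ioi 0, du y * ∫ x in Ioo 0 y, m * x ^ (m - 1) =
      ∫ y in Ioi 0, du y * y ^ m :=
    setIntegral_congr_fun measurableSet_Ioi fun y hy => by simp only [hkernel y hy]
  have hle : ∫ x in Ioi 0, -(∫ y in Ioi x, du y * (m * x ^ (m - 1))) ≤ ∫ x in Ioi 0, w x := by
    refine setIntegral_mono_on hint.neg hw_int measurableSet_Ioi fun x hx => ?_
    refine le_trans ?_ (hvw x hx)
    have hx' : 0 < x ^ (m - 1) := Real.rpow_pos_of_pos hx _
    rw [integral_mul_const]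
    nlinarith [mul_le_mul_of_nonneg_right (htail x hx)
      (by positivity : 0 ≤ m * x ^ (m - 1))]
  rw [integral_neg, hswap, hswap'] at hle
  have hsplit : ∫ x in Ioi 0, du x * (1 + x ^ m) =
      (∫ x in Ioi 0, du x) + ∫ x in Ioi 0, du x * x ^ m := by
    rw [← integral_add hdu hdum]
    simp only [mul_add, mul_one]
  linarith

/-- The `m`-th weight of the fragments is at most their number plus the `m`-th power of the
size of the parent. -/
theorem integral_kernel_mul_one_add_rpow {m y : ℝ} (hm : 1 < m) (hy : 0 < y) {f : ℝ → ℝ}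
    (hf_meas : Measurable f) (hf_nonneg : ∀ x, 0 ≤ f x)
    (hf_mass_int : IntegrableOn (fun x => x * f x) (Ioo 0 y))
    (hf_int : IntegrableOn f (Ioo 0 y))
    (hmass : ∫ x in Ioo (0 : ℝ) y, x * f x = y) :
    IntegrableOn (fun x => f x * (1 + x ^ m)) (Ioo 0 y) ∧
    ∫ x in Ioo 0 y, f x * (1 + x ^ m) ≤ (∫ x in Ioo 0 y, f x) + y ^ m := by
  have hdom : IntegrableOn (fun x => f x + y ^ (m - 1) * (x * f x)) (Ioo 0 y) :=
    hf_int.add (hf_mass_int.const_mul _)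
  have hle (x : ℝ) (hx : x ∈ Ioo 0 y) :
      f x * (1 + x ^ m) ≤ f x + y ^ (m - 1) * (x * f x) := by
    have hpow : x ^ m = x ^ (m - 1) * x := by
      rw [← Real.rpow_add_one hx.1.ne', sub_add_cancel]
    have hmono : x ^ (m - 1) ≤ y ^ (m - 1) :=
      Real.rpow_le_rpow hx.1.le hx.2.le (by linarith)
    have := mul_le_mul_of_nonneg_right hmono (mul_nonneg hx.1.le (hf_nonneg x))
    rw [hpow]
    linarith
  have hint : IntegrableOn (fun x => f x * (1 + x ^ m)) (Ioo 0 y) := by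
    refine Integrable.mono' hdom (by fun_prop) ?_
    filter_upwards [ae_restrict_mem measurableSet_Ioo] with x hx
    have hx' : 0 < x ^ m := Real.rpow_pos_of_pos hx.1 m
    rw [Real.norm_of_nonneg (mul_nonneg (hf_nonneg x) (by linarith))]
    exact hle x hx
  refine ⟨hint, (setIntegral_mono_on hint hdom measurableSet_Ioo hle).trans_eq ?_⟩
  rw [integral_add hf_int (hf_mass_int.const_mul _), integral_const_mul, hmass,
    ← Real.rpow_add_one hy.ne', sub_add_cancel]

/-- The quasi-dissipativity estimate: for nonnegative `u` in the domain of
the growth–fragmentation operator with McKendrick–von Foerster boundary condition,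
`∫₀^∞ [(Z_{β,m}+B_m)u](x)(1+x^m) dx ≤ (β_m + 2 m r₀ + 4 a₀ b₀) ‖u‖_m`. -/
theorem quasi_dissipativity (m p l a₀ b₀ r₀ betam : ℝ) (r a β u du : ℝ → ℝ)
    (b : ℝ → ℝ → ℝ)
    (hm : 1 < m) (hp : 0 ≤ p) (hl : 0 ≤ l) (hlp : l + p ≤ m) (hb₀ : 1 ≤ b₀)
    (hr₀ : 0 < r₀) (ha₀ : 0 ≤ a₀) (hbetam : 0 ≤ betam)
    (hr_cont : ContinuousOn r (Ioi 0))
    (hr_pos : ∀ x, 0 < x → 0 < r x)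
    (hr_bound : ∀ x, 0 < x → r x ≤ r₀ * (1 + x))
    (ha_meas : Measurable a)
    (ha_bound : ∀ x, 0 < x → 0 ≤ a x ∧ a x ≤ a₀ * (1 + x ^ p))
    (hβ_meas : Measurable β)
    (hβ_bound : ∀ x, 0 < x → 0 ≤ β x ∧ β x ≤ betam * (1 + x ^ m))
    (hb_meas : Measurable (Function.uncurry b))
    (hb_nonneg : ∀ x y, 0 ≤ b x y)
    (hb_supp : ∀ x y, y < x → b x y = 0)
    (hb_int : ∀ y, 0 < y → IntegrableOn (fun x => x * b x y) (Ioo 0 y) ∧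
      IntegrableOn (fun x => b x y) (Ioo 0 y))
    (hmass : ∀ y, 0 < y → ∫ x in Ioo (0:ℝ) y, x * b x y = y)
    (hn0 : ∀ y, 0 < y → ∫ x in Ioo (0:ℝ) y, b x y ≤ b₀ * (1 + y ^ l))
    (hu_meas : Measurable u) (hu_nonneg : ∀ x, 0 < x → 0 ≤ u x)
    (hu_int : IntegrableOn (fun x => u x * (1 + x ^ m)) (Ioi 0))
    (hau_int : IntegrableOn (fun x => a x * u x * (1 + x ^ m)) (Ioi 0))
    (hdu_int : IntegrableOn (fun x => du x * (1 + x ^ m)) (Ioi 0))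
    (hFTC : ∀ x₀ x₁ : ℝ, 0 < x₀ → x₀ ≤ x₁ →
      r x₁ * u x₁ - r x₀ * u x₀ = ∫ s in x₀..x₁, du s)
    (hbc : Tendsto (fun x => r x * u x) (nhdsWithin 0 (Ioi 0))
      (nhds (∫ x in Ioi 0, β x * u x))) :
    ∫ x in Ioi 0, (-(du x) - a x * u x + ∫ y in Ioi x, a y * b x y * u y) * (1 + x ^ m)
      ≤ (betam + 2 * m * r₀ + 4 * a₀ * b₀) * ∫ x in Ioi 0, u x * (1 + x ^ m) := by
  set N : ℝ → ℝ := fun x => u x * (1 + x ^ m) with hN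
  have htransport : -∫ x in Ioi 0, du x * (1 + x ^ m) ≤
      betam * (∫ x in Ioi 0, N x) + 2 * m * r₀ * ∫ x in Ioi 0, N x := by
    have h := neg_integral_mul_one_add_rpow_le hm (v := fun x => r x * u x)
      (w := fun x => 2 * m * r₀ * N x)
      (fun x hx => mul_nonneg (hr_pos x hx).le (hu_nonneg x hx)) hdu_int hFTC hbc
      (hu_int.const_mul _) (fun x hx => by
        have hu := hu_nonneg x hx
        have hx' : 0 < x ^ (m - 1) := Real.rpow_pos_of_pos hx _
        have hpow : x ^ m = x ^ (m - 1) * x := by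
          rw [← Real.rpow_add_one hx.ne', sub_add_cancel]
        have h₁ : x ^ (m - 1) ≤ 1 + x ^ m :=
          rpow_le_one_add_rpow hx (by linarith) (by linarith)
        calc m * x ^ (m - 1) * (r x * u x)
            ≤ m * x ^ (m - 1) * (r₀ * (1 + x) * u x) := by
              gcongr
              exact hr_bound x hx
          _ = m * r₀ * u x * (x ^ (m - 1) + x ^ m) := by rw [hpow]; ring
          _ ≤ m * r₀ * u x * (2 * (1 + x ^ m)) := by
              gcongr
              linarith
          _ = 2 * m * r₀ * (u x * (1 + x ^ m)) := by ring)
    rw [integral_const_mul] at h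
    refine h.trans (add_le_add_left ?_ _)
    rw [← integral_const_mul]
    refine integral_mono_of_nonneg ?_ (hu_int.const_mul _) ?_
    · filter_upwards [ae_restrict_mem measurableSet_Ioi] with x hx
      exact mul_nonneg (hβ_bound x hx).1 (hu_nonneg x hx)
    · filter_upwards [ae_restrict_mem measurableSet_Ioi] with x hx
      have := mul_le_mul_of_nonneg_right (hβ_bound x hx).2 (hu_nonneg x hx)
      simp only [hN]
      linarith
  have hkernel (y : ℝ) (hy : 0 < y) := integral_kernel_mul_one_add_rpow hm hy
    (f := fun x => b x y) (hb_meas.comp measurable_prodMk_right) (fun x => hb_nonneg x y)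
    (hb_int y hy).1 (hb_int y hy).2 (hmass y hy)
  have hgain (y : ℝ) (hy : 0 < y) :
      a y * u y * ∫ x in Ioo 0 y, b x y * (1 + x ^ m) ≤
        4 * a₀ * b₀ * N y + a y * u y * (1 + y ^ m) := by
    obtain ⟨ha, ha'⟩ := ha_bound y hy
    have hu := hu_nonneg y hy
    have hn : ∫ x in Ioo 0 y, b x y * (1 + x ^ m) ≤ b₀ * (1 + y ^ l) + y ^ m :=
      (hkernel y hy).2.trans (add_le_add_left (hn0 y hy) _)
    have hweight : (1 + y ^ p) * (1 + y ^ l) ≤ 4 * (1 + y ^ m) := by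
      have h₁ := rpow_le_one_add_rpow hy hp (by linarith : p ≤ m)
      have h₂ := rpow_le_one_add_rpow hy hl (by linarith : l ≤ m)
      have h₃ := rpow_le_one_add_rpow hy (by linarith : 0 ≤ l + p) hlp
      have h₄ : 0 < y ^ m := Real.rpow_pos_of_pos hy m
      rw [Real.rpow_add hy] at h₃
      linarith
    have hl' : 0 < y ^ l := Real.rpow_pos_of_pos hy l
    calc a y * u y * ∫ x in Ioo 0 y, b x y * (1 + x ^ m)
        ≤ a y * u y * (b₀ * (1 + y ^ l) + y ^ m) := by gcongr
      _ = a y * (u y * b₀ * (1 + y ^ l)) + a y * u y * y ^ m := by ring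
      _ ≤ a₀ * (1 + y ^ p) * (u y * b₀ * (1 + y ^ l)) + a y * u y * (1 + y ^ m) := by
          gcongr
          linarith
      _ = a₀ * b₀ * u y * ((1 + y ^ p) * (1 + y ^ l)) + a y * u y * (1 + y ^ m) := by ring
      _ ≤ a₀ * b₀ * u y * (4 * (1 + y ^ m)) + a y * u y * (1 + y ^ m) := by gcongr
      _ = 4 * a₀ * b₀ * N y + a y * u y * (1 + y ^ m) := by simp only [hN]; ring
  have hD : IntegrableOn (fun y => 4 * a₀ * b₀ * N y + a y * u y * (1 + y ^ m)) (Ioi 0) :=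
    (hu_int.const_mul _).add hau_int
  have hk_meas : Measurable (Function.uncurry fun y x => b x y * (1 + x ^ m)) := by
    have : Measurable fun q : ℝ × ℝ => b q.2 q.1 := hb_meas.comp measurable_swap
    unfold Function.uncurry
    fun_prop
  obtain ⟨hfrag_int, hgain_int, hswap⟩ := integrable_and_integral_swap_triangle
    (g := fun y => a y * u y) (k := fun y x => b x y * (1 + x ^ m))
    (ha_meas.mul hu_meas).aestronglyMeasurable hk_meas
    (fun y x hx => mul_nonneg (hb_nonneg x y) (by positivity))
    (fun y hy => (hkernel y hy).1) hD
    (fun y hy => by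
      rw [abs_of_nonneg (mul_nonneg (ha_bound y hy).1 (hu_nonneg y hy))]
      exact hgain y hy)
  have hfrag : ∫ x in Ioi 0, ∫ y in Ioi x, a y * u y * (b x y * (1 + x ^ m)) ≤
      4 * a₀ * b₀ * (∫ x in Ioi 0, N x) + ∫ x in Ioi 0, a x * u x * (1 + x ^ m) := by
    rw [hswap, ← integral_const_mul, ← integral_add (hu_int.const_mul _) hau_int]
    exact setIntegral_mono_on hgain_int hD measurableSet_Ioi hgain
  have hsplit (x : ℝ) :
      (-(du x) - a x * u x + ∫ y in Ioi x, a y * b x y * u y) * (1 + x ^ m) =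
        -(du x * (1 + x ^ m)) - a x * u x * (1 + x ^ m) +
          ∫ y in Ioi x, a y * u y * (b x y * (1 + x ^ m)) := by
    rw [add_mul, ← integral_mul_const]
    congr 1
    · ring
    · congr 1
      ext y
      ring
  simp only [hsplit]
  have hdu_neg : IntegrableOn (fun x => -(du x * (1 + x ^ m))) (Ioi 0) := hdu_int.neg
  have hloss_int : IntegrableOn (fun x => -(du x * (1 + x ^ m)) - a x * u x * (1 + x ^ m))
      (Ioi 0) := hdu_neg.sub hau_int
  rw [integral_add hloss_int hfrag_int, integral_sub hdu_neg hau_int, integral_neg]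
  linarith
end
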